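/- arXiv:2505.20397 — 2 statements merged into one kernel-verified Lean document; each statement's English description precedes it below -/
import Mathlib

section
/- Let P and Q be polynomials with coefficients in ℚ̄, with Q ≠ 0, and let γ : [0,1] → ℂ be a continuously differentiable path such that Q(γ(t)) ≠ 0 for all t ∈ [0,1] and such that both endpoints γ(0) and γ(1) lie in ℚ̄. Then the path integral ∫₀¹ (P(γ(t))/Q(γ(t))) · γ'(t) dt lies in the ℚ̄-linear span, inside ℂ regarded as a vector space over ℚ̄, of the finite set {1, 2πi} ∪ { log(e − d) : e ∈ {γ(0), γ(1)}, d a root of Q in ℂ }, where log denotes the principal branch of the complex logarithm. -/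
open scoped Real

/-- `ℚ̄`, the field of algebraic numbers, as an intermediate field of `ℂ / ℚ`. -/
noncomputable abbrev Qbar : IntermediateField ℚ ℂ := algebraicClosure ℚ ℂ

section

open MeasureTheory intervalIntegral

/-- The integral along a `C¹` path of a function with a primitive near the path. -/
lemma integral_comp_mul_derivWithin_eq_sub {γ : ℝ → ℂ} (hγ : ContDiffOn ℝ 1 γ (Set.Icc 0 1))
    {F f : ℂ → ℂ} (hF : ∀ t ∈ Set.Icc (0 : ℝ) 1, HasDerivAt F (f (γ t)) (γ t))
    (hf : ContinuousOn (fun t => f (γ t)) (Set.Icc 0 1)) :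
    ∫ t in (0 : ℝ)..1, f (γ t) * derivWithin γ (Set.Icc 0 1) t = F (γ 1) - F (γ 0) := by
  have hcont := hγ.continuousOn_derivWithin (uniqueDiffOn_Icc zero_lt_one) le_rfl
  refine integral_eq_sub_of_hasDerivAt_of_le (f := fun t => F (γ t)) zero_le_one ?_ ?_ ?_
  · exact fun t ht => (hF t ht).continuousAt.comp_continuousWithinAt (hγ.continuousOn t ht)
  · intro t ht
    have htI := Set.Ioo_subset_Icc_self ht
    have hd := ((hγ.differentiableOn one_ne_zero t htI).hasDerivWithinAt).hasDerivAt
      (Icc_mem_nhds ht.1 ht.2)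
    exact (hF t htI).comp_of_eq t hd rfl
  · exact (hf.mul hcont).intervalIntegrable_of_Icc zero_le_one

/-- The exponential of the integral of `dz / (z - d)` along a `C¹` path avoiding `d`. -/
lemma exp_integral_inv_sub_mul_derivWithin {γ : ℝ → ℂ} (hγ : ContDiffOn ℝ 1 γ (Set.Icc 0 1))
    {d : ℂ} (hd : ∀ t ∈ Set.Icc (0 : ℝ) 1, γ t - d ≠ 0) :
    Complex.exp (∫ t in (0 : ℝ)..1, (γ t - d)⁻¹ * derivWithin γ (Set.Icc 0 1) t)
      = (γ 1 - d) / (γ 0 - d) := by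
  have hcont := hγ.continuousOn_derivWithin (uniqueDiffOn_Icc zero_lt_one) le_rfl
  set g : ℝ → ℂ := fun t => (γ t - d)⁻¹ * derivWithin γ (Set.Icc 0 1) t with hg
  have hgc : ContinuousOn g (Set.Icc 0 1) :=
    ((hγ.continuousOn.sub continuousOn_const).inv₀ hd).mul hcont
  have hI : ∀ t ∈ Set.Icc (0 : ℝ) 1,
      HasDerivWithinAt (fun u => ∫ x in (0 : ℝ)..u, g x) (g t) (Set.Icc 0 1) t := by
    intro t ht
    have := Fact.mk ht
    apply integral_hasDerivWithinAt_right
    · exact (hgc.mono (Set.Icc_subset_Icc le_rfl ht.2)).intervalIntegrable_of_Icc ht.1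
    · exact hgc.stronglyMeasurableAtFilter_nhdsWithin measurableSet_Icc t
    · exact hgc t ht
  have hH : ∀ t ∈ Set.Icc (0 : ℝ) 1, HasDerivWithinAt
      (fun u => Complex.exp (-∫ x in (0 : ℝ)..u, g x) * (γ u - d)) 0 (Set.Icc 0 1) t := by
    intro t ht
    have h1 := (hI t ht).neg.cexp
    have h2 := ((hγ.differentiableOn one_ne_zero t ht).hasDerivWithinAt).sub_const d
    refine (h1.mul h2).congr_deriv ?_
    have := hd t ht
    simp only [hg]
    field_simp
    ring
  have key := constant_of_derivWithin_zero (fun t ht => (hH t ht).differentiableWithinAt)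
    (fun t ht => (hH t (Set.Ico_subset_Icc_self ht)).derivWithin
      (uniqueDiffOn_Icc zero_lt_one t (Set.Ico_subset_Icc_self ht)))
    1 (Set.right_mem_Icc.2 zero_le_one)
  have h0 := hd 0 (Set.left_mem_Icc.2 zero_le_one)
  simp only [integral_same, neg_zero, Complex.exp_zero, one_mul, Complex.exp_neg] at key
  rw [eq_div_iff h0, ← key, mul_inv_cancel_left₀ (Complex.exp_ne_zero _)]

/-- The integral of `dz / (z - d)` is a difference of logarithms up to a multiple of `2πi`. -/
lemma exists_integral_inv_sub_mul_derivWithin {γ : ℝ → ℂ}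
    (hγ : ContDiffOn ℝ 1 γ (Set.Icc 0 1))
    {d : ℂ} (hd : ∀ t ∈ Set.Icc (0 : ℝ) 1, γ t - d ≠ 0) :
    ∃ n : ℤ, ∫ t in (0 : ℝ)..1, (γ t - d)⁻¹ * derivWithin γ (Set.Icc 0 1) t
      = Complex.log (γ 1 - d) - Complex.log (γ 0 - d) + n * (2 * Real.pi * Complex.I) := by
  refine Complex.exp_eq_exp_iff_exists_int.1 ?_
  rw [exp_integral_inv_sub_mul_derivWithin hγ hd,
    Complex.exp_sub, Complex.exp_log (hd 1 (by simp)), Complex.exp_log (hd 0 (by simp))]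

lemma mem_span_Qbar_of_isAlgebraic {s : Set ℂ} (hs : 1 ∈ s) {x : ℂ} (hx : IsAlgebraic ℚ x) :
    x ∈ Submodule.span Qbar s := by
  have h := Submodule.smul_mem (Submodule.span Qbar s)
    (⟨x, mem_algebraicClosure_iff.2 hx⟩ : Qbar) (Submodule.subset_span hs)
  rwa [IntermediateField.smul_def, smul_eq_mul, mul_one] at h

lemma isAlgebraic_coe_Qbar (x : Qbar) : IsAlgebraic ℚ (x : ℂ) :=
  mem_algebraicClosure_iff.1 x.2

/-- The integral of a polynomial differential along a path with algebraic endpoints is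
algebraic. -/
lemma isAlgebraic_integral_aeval_mul_derivWithin {γ : ℝ → ℂ}
    (hγ : ContDiffOn ℝ 1 γ (Set.Icc 0 1))
    (h0 : IsAlgebraic ℚ (γ 0)) (h1 : IsAlgebraic ℚ (γ 1)) (q : Polynomial Qbar) :
    IsAlgebraic ℚ
      (∫ t in (0 : ℝ)..1, Polynomial.aeval (γ t) q * derivWithin γ (Set.Icc 0 1) t) := by
  have hcont := hγ.continuousOn_derivWithin (uniqueDiffOn_Icc zero_lt_one) le_rfl
  have hc (p : Polynomial Qbar) : ContinuousOn (fun t => Polynomial.aeval (γ t) p)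
      (Set.Icc 0 1) := p.continuous_aeval.comp_continuousOn hγ.continuousOn
  have hint (p : Polynomial Qbar) : IntervalIntegrable
      (fun t => Polynomial.aeval (γ t) p * derivWithin γ (Set.Icc 0 1) t) volume 0 1 :=
    ((hc p).mul hcont).intervalIntegrable_of_Icc zero_le_one
  induction q using Polynomial.induction_on' with
  | add p q hp hq =>
    simp only [map_add, add_mul]
    rw [integral_add (hint p) (hint q)]
    exact hp.add hq
  | monomial n a =>
    rw [integral_comp_mul_derivWithin_eq_sub hγ
      (F := fun z => (a : ℂ) * (z ^ (n + 1) / (n + 1 : ℕ)))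
      (f := fun z => Polynomial.aeval z (Polynomial.monomial n a)) ?_ (hc _)]
    · have hn : IsAlgebraic ℚ ((n + 1 : ℕ) : ℂ)⁻¹ := (isAlgebraic_natCast _).inv
      simp only [div_eq_mul_inv]
      exact ((isAlgebraic_coe_Qbar a).mul ((h1.pow _).mul hn)).sub
        ((isAlgebraic_coe_Qbar a).mul ((h0.pow _).mul hn))
    · intro t _
      have := (((hasDerivAt_pow (n + 1) (γ t)).div_const ((n + 1 : ℕ) : ℂ)).const_mul (a : ℂ))
      refine this.congr_deriv ?_
      have hn : ((n + 1 : ℕ) : ℂ) ≠ 0 := Nat.cast_ne_zero.2 n.succ_ne_zero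
      rw [Polynomial.aeval_monomial, Nat.add_sub_cancel, mul_div_cancel_left₀ _ hn]
      rfl

/-- The integral of `dz / (z - d) ^ (n + 2)` along a path with algebraic endpoints is
algebraic. -/
lemma isAlgebraic_integral_inv_sub_pow_mul_derivWithin {γ : ℝ → ℂ}
    (hγ : ContDiffOn ℝ 1 γ (Set.Icc 0 1))
    (h0 : IsAlgebraic ℚ (γ 0)) (h1 : IsAlgebraic ℚ (γ 1)) {d : ℂ} (hda : IsAlgebraic ℚ d)
    (hd : ∀ t ∈ Set.Icc (0 : ℝ) 1, γ t - d ≠ 0) (n : ℕ) :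
    IsAlgebraic ℚ
      (∫ t in (0 : ℝ)..1, (γ t - d)⁻¹ ^ (n + 2) * derivWithin γ (Set.Icc 0 1) t) := by
  have hn : ((n + 1 : ℕ) : ℂ) ≠ 0 := Nat.cast_ne_zero.2 n.succ_ne_zero
  have hinv := (hγ.continuousOn.sub continuousOn_const).inv₀ hd
  rw [integral_comp_mul_derivWithin_eq_sub hγ
    (F := fun z => -((z - d)⁻¹ ^ (n + 1) / (n + 1 : ℕ)))
    (f := fun z => (z - d)⁻¹ ^ (n + 2)) ?_ (hinv.pow _)]
  · have hn : IsAlgebraic ℚ ((n + 1 : ℕ) : ℂ)⁻¹ := (isAlgebraic_natCast _).inv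
    simp only [div_eq_mul_inv]
    exact (((h1.sub hda).inv.pow _).mul hn).neg.sub (((h0.sub hda).inv.pow _).mul hn).neg
  · intro t ht
    have h := hd t ht
    have := ((((hasDerivAt_id (γ t)).sub_const d).inv h).pow (n + 1)).div_const
      ((n + 1 : ℕ) : ℂ) |>.neg
    refine this.congr_deriv ?_
    simp only [id, Pi.inv_apply, Nat.add_sub_cancel, inv_pow]
    field_simp
    ring

/-- Partial fractions over an algebraically closed field `k`, evaluated along a family `z` of
points where the denominator does not vanish. -/
lemma exists_aeval_div_eq_add_sum {k K ι : Type*} [Field k] [IsAlgClosed k] [DecidableEq k]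
    [Field K] [Algebra k K] (P : Polynomial k) {Q : Polynomial k} (hQ : Q ≠ 0) (z : ι → K)
    (hz : ∀ t, Polynomial.aeval (z t) Q ≠ 0) :
    ∃ (q : Polynomial k) (r : (d : k) → Fin (Q.roots.count d) → k), ∀ t,
      Polynomial.aeval (z t) P / Polynomial.aeval (z t) Q = Polynomial.aeval (z t) q +
        ∑ d ∈ Q.roots.toFinset, ∑ j, algebraMap k K (r d j) *
          (z t - algebraMap k K d)⁻¹ ^ (j.1 + 1) := by
  let : Algebra (Polynomial k) (ι → K) :=
    (RingHom.pi fun t => (Polynomial.aeval (R := k) (z t)).toRingHom).toAlgebra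
  have halg (f : Polynomial k) (t : ι) :
      algebraMap (Polynomial k) (ι → K) f t = Polynomial.aeval (z t) f := rfl
  have hroot : ∀ d ∈ Q.roots.toFinset, ∀ t, z t - algebraMap k K d ≠ 0 := by
    intro d hd t h
    rw [Multiset.mem_toFinset, Polynomial.mem_roots hQ] at hd
    apply hz t
    rw [sub_eq_zero.1 h, Polynomial.aeval_algebraMap_apply, Polynomial.aeval_def,
      Polynomial.eval₂_eq_eval_map]
    simp [hd.eq_zero]
  obtain ⟨q, r, hr, h⟩ := Polynomial.mul_prod_pow_inverse_eq_quo_add_sum_rem_mul_pow_inverse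
    (K := ι → K) (s := Q.roots.toFinset) (Polynomial.C Q.leadingCoeff⁻¹ * P)
    (g := fun d => Polynomial.X - Polynomial.C d) (fun d _ => Polynomial.monic_X_sub_C d)
    (fun a _ b _ hab => Polynomial.pairwise_coprime_X_sub_C Function.injective_id hab)
    (fun d => Q.roots.count d) (gi := fun d t => (z t - algebraMap k K d)⁻¹)
    (by
      intro d hd
      ext t
      simp [halg, hroot d hd t])
  refine ⟨q, fun d j => (r d j).coeff 0, fun t => ?_⟩
  have hQt : Polynomial.aeval (z t) Q = algebraMap k K Q.leadingCoeff *
      ∏ d ∈ Q.roots.toFinset, (z t - algebraMap k K d) ^ Q.roots.count d := by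
    conv_lhs => rw [(IsAlgClosed.splits Q).eq_prod_roots, Finset.prod_multiset_map_count]
    simp [map_prod]
  have ht := congrFun h t
  simp only [Pi.mul_apply, Finset.prod_apply, Pi.add_apply, Finset.sum_apply, Pi.pow_apply,
    halg, map_mul, Polynomial.aeval_C, map_inv₀] at ht
  rw [hQt, div_eq_mul_inv, mul_inv, ← Finset.prod_inv_distrib]
  simp only [← inv_pow]
  rw [← mul_assoc, mul_comm _ (algebraMap k K Q.leadingCoeff)⁻¹, ht]
  congr 1
  refine Finset.sum_congr rfl fun d hd => Finset.sum_congr rfl fun j _ => ?_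
  have hdeg := hr d hd j
  rw [Polynomial.degree_X_sub_C] at hdeg
  rw [Polynomial.eq_C_of_degree_le_zero (Order.le_of_lt_succ hdeg)]
  simp

end

/-- Baker period entries in standard form: for polynomials `P`, `Q` with algebraic
coefficients, `Q ≠ 0`, and a `C¹` path `γ` avoiding the zeros of `Q` whose endpoints are
algebraic, the integral `∫₀¹ (P(γ(t))/Q(γ(t)))·γ'(t) dt` lies in the `ℚ̄`-linear span of
`1`, `2πi`, and the logarithms `log (e - d)` for `e` an endpoint of `γ` and `d` a root
of `Q`. -/
theorem baker_period_entry_standard_form (P Q : Polynomial ℂ)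
    (hP : ∀ n, IsAlgebraic ℚ (P.coeff n)) (hQalg : ∀ n, IsAlgebraic ℚ (Q.coeff n))
    (hQ : Q ≠ 0) (γ : ℝ → ℂ) (hγ : ContDiffOn ℝ 1 γ (Set.Icc 0 1))
    (hQγ : ∀ t ∈ Set.Icc (0:ℝ) 1, Q.eval (γ t) ≠ 0)
    (h0 : IsAlgebraic ℚ (γ 0)) (h1 : IsAlgebraic ℚ (γ 1)) :
    (∫ t in (0:ℝ)..1, (P.eval (γ t) / Q.eval (γ t)) * derivWithin γ (Set.Icc 0 1) t)
      ∈ Submodule.span Qbar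
          (({1, 2 * Real.pi * Complex.I} : Set ℂ)
            ∪ {x : ℂ | ∃ e ∈ ({γ 0, γ 1} : Set ℂ), ∃ d : ℂ, Q.IsRoot d
                ∧ x = Complex.log (e - d)}) := by
  classical
  have hlift (p : Polynomial ℂ) (hp : ∀ n, IsAlgebraic ℚ (p.coeff n)) :
      ∃ p' : Polynomial Qbar, p'.map (algebraMap Qbar ℂ) = p :=
    (Polynomial.mem_lifts p).1 <| (Polynomial.lifts_iff_coeff_lifts p).2 fun n =>
      ⟨⟨p.coeff n, mem_algebraicClosure_iff.2 (hp n)⟩, rfl⟩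
  obtain ⟨P, rfl⟩ := hlift P hP
  obtain ⟨Q, rfl⟩ := hlift Q hQalg
  have hQ0 : Q ≠ 0 := by
    rintro rfl
    simp at hQ
  simp only [Polynomial.eval_map_algebraMap] at hQγ ⊢
  have : IsAlgClosed Qbar := (algebraicClosure.isAlgClosure ℚ ℂ).isAlgClosed
  set T : Set ℂ := _ ∪ _
  have hT1 : (1 : ℂ) ∈ T := Or.inl (Or.inl rfl)
  obtain ⟨q, r, hqr⟩ := exists_aeval_div_eq_add_sum P hQ0
    (fun t : Set.Icc (0 : ℝ) 1 => γ t) (fun t => hQγ t t.2)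
  have hroot : ∀ d ∈ Q.roots.toFinset, (Q.map (algebraMap Qbar ℂ)).IsRoot (d : ℂ) := by
    intro d hd
    rw [Multiset.mem_toFinset, Polynomial.mem_roots hQ0] at hd
    exact hd.map
  have hne : ∀ d ∈ Q.roots.toFinset, ∀ t ∈ Set.Icc (0 : ℝ) 1, γ t - (d : ℂ) ≠ 0 := by
    intro d hd t ht h
    apply hQγ t ht
    rw [sub_eq_zero.1 h, ← Polynomial.eval_map_algebraMap]
    exact hroot d hd
  have hcont := hγ.continuousOn_derivWithin (uniqueDiffOn_Icc zero_lt_one) le_rfl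
  have hint : ∀ d ∈ Q.roots.toFinset, ∀ j : Fin (Q.roots.count d), IntervalIntegrable
      (fun t => (r d j : ℂ) * ((γ t - (d : ℂ))⁻¹ ^ (j.1 + 1) * derivWithin γ (Set.Icc 0 1) t))
      MeasureTheory.volume 0 1 := fun d hd j =>
    (continuousOn_const.mul ((((hγ.continuousOn.sub continuousOn_const).inv₀
      (hne d hd)).pow _).mul hcont)).intervalIntegrable_of_Icc zero_le_one
  have hint_sum : ∀ d ∈ Q.roots.toFinset, IntervalIntegrable
      (fun t => ∑ j, (r d j : ℂ) *
        ((γ t - (d : ℂ))⁻¹ ^ (j.1 + 1) * derivWithin γ (Set.Icc 0 1) t))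
      MeasureTheory.volume 0 1 := fun d hd => by
    simpa only [Finset.sum_fn] using IntervalIntegrable.sum _ fun j _ => hint d hd j
  have hexpand : ∫ t in (0 : ℝ)..1, Polynomial.aeval (γ t) P / Polynomial.aeval (γ t) Q *
        derivWithin γ (Set.Icc 0 1) t =
      (∫ t in (0 : ℝ)..1, Polynomial.aeval (γ t) q * derivWithin γ (Set.Icc 0 1) t) +
        ∑ d ∈ Q.roots.toFinset, ∑ j, (r d j : ℂ) *
          ∫ t in (0 : ℝ)..1, (γ t - (d : ℂ))⁻¹ ^ (j.1 + 1) * derivWithin γ (Set.Icc 0 1) t := by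
    simp only [← intervalIntegral.integral_const_mul]
    rw [Finset.sum_congr rfl fun d hd =>
        (intervalIntegral.integral_finsetSum fun j _ => hint d hd j).symm,
      ← intervalIntegral.integral_finsetSum hint_sum,
      ← intervalIntegral.integral_add]
    · refine intervalIntegral.integral_congr fun t ht => ?_
      rw [Set.uIcc_of_le zero_le_one] at ht
      simp only [hqr ⟨t, ht⟩, add_mul, Finset.sum_mul, mul_assoc]
      rfl
    · exact ((q.continuous_aeval.comp_continuousOn hγ.continuousOn).mul
        hcont).intervalIntegrable_of_Icc zero_le_one
    · simpa only [Finset.sum_fn] using IntervalIntegrable.sum _ hint_sum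
  rw [hexpand]
  refine add_mem (mem_span_Qbar_of_isAlgebraic hT1
    (isAlgebraic_integral_aeval_mul_derivWithin hγ h0 h1 q))
    (sum_mem fun d hd => sum_mem fun j _ => Submodule.smul_mem _ (r d j) ?_)
  obtain ⟨j, hj⟩ := j
  cases j with
  | zero =>
    obtain ⟨n, hn⟩ := exists_integral_inv_sub_mul_derivWithin hγ (hne d hd)
    simp only [zero_add, pow_one]
    rw [hn]
    refine add_mem (sub_mem (Submodule.subset_span ?_) (Submodule.subset_span ?_)) ?_
    · exact Or.inr ⟨γ 1, by simp, d, hroot d hd, rfl⟩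
    · exact Or.inr ⟨γ 0, by simp, d, hroot d hd, rfl⟩
    · rw [← zsmul_eq_mul]
      have hpi : 2 * Real.pi * Complex.I ∈ T := Or.inl (Or.inr rfl)
      exact zsmul_mem (Submodule.subset_span hpi) n
  | succ j =>
    exact mem_span_Qbar_of_isAlgebraic hT1
      (isAlgebraic_integral_inv_sub_pow_mul_derivWithin hγ h0 h1 (isAlgebraic_coe_Qbar d)
        (hne d hd) j)
end

section
/- Assume Baker's theorem in the following form: for every finite list ℓ₁, …, ℓ_m of complex numbers with exp(ℓᵢ) ∈ ℚ̄ for all i, if ℓ₁, …, ℓ_m are linearly independent over ℚ, then the numbers 1, ℓ₁, …, ℓ_m are linearly independent over ℚ̄. Then for any complex numbers ℓ₁, …, ℓₙ with exp(ℓᵢ) ∈ ℚ̄ for all i, the ℚ̄-subspace R = { c ∈ ℚ̄ⁿ : Σᵢ cᵢ·ℓᵢ = 0 } of ℚ̄ⁿ is spanned over ℚ̄ by its rational points R ∩ ℚⁿ. -/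
set_option synthInstance.maxHeartbeats 1000000
/-- If every `K`-linearly independent subfamily of `v` is `F`-linearly independent, then the
`F`-linear relations among the `v i` are spanned over `F` by the `K`-linear ones. -/
theorem mem_span_relations_of_linearIndependent {K F M ι : Type*} [Field K] [Field F] [Algebra K F]
    [AddCommGroup M] [Module K M] [Module F M] [IsScalarTower K F M] [Fintype ι] (v : ι → M)
    (h : ∀ (m : ℕ) (a : Fin m → ι), LinearIndependent K (v ∘ a) → LinearIndependent F (v ∘ a))
    (c : ι → F) (hc : ∑ i, c i • v i = 0) :
    c ∈ Submodule.span F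
      {d : ι → F | ∑ i, d i • v i = 0 ∧ ∀ i, ∃ q : K, d i = algebraMap K F q} := by
  classical
  obtain ⟨κ, a, ha, hspan, hli⟩ := exists_linearIndependent' K v
  have : Finite κ := Finite.of_injective a ha
  obtain ⟨m, ⟨e⟩⟩ := Finite.exists_equiv_fin κ
  have hb : LinearIndependent K (v ∘ (a ∘ e.symm)) := hli.comp _ e.symm.injective
  have hrange : Set.range (v ∘ (a ∘ e.symm)) = Set.range (v ∘ a) :=
    e.symm.surjective.range_comp (v ∘ a)
  generalize a ∘ e.symm = b at hb hrange
  have hq : ∀ i, ∃ q : Fin m → K, ∑ k, q k • v (b k) = v i := fun i ↦ by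
    have hi : v i ∈ Submodule.span K (Set.range (v ∘ b)) := by
      rw [hrange, hspan]
      exact Submodule.subset_span ⟨i, rfl⟩
    exact (Submodule.mem_span_range_iff_exists_fun K).mp hi
  choose q hq using hq
  have hcoeff : ∀ k, ∑ i, c i * algebraMap K F (q i k) = 0 := by
    refine Fintype.linearIndependent_iff.mp (h m b hb) _ ?_
    simp only [Function.comp_apply, Finset.sum_smul]
    rw [Finset.sum_comm, ← hc]
    refine Finset.sum_congr rfl fun i _ ↦ ?_
    simp only [mul_smul, algebraMap_smul, ← Finset.smul_sum, hq]
  let d : ι → ι → F := fun i ↦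
    Pi.single i 1 - ∑ k, algebraMap K F (q i k) • Pi.single (b k) 1
  have hcd : c = ∑ i, c i • d i := by
    simp only [d, smul_sub, Finset.sum_sub_distrib, Finset.smul_sum, smul_smul]
    rw [Finset.sum_comm]
    simp only [← Finset.sum_smul, hcoeff, zero_smul, Finset.sum_const_zero, sub_zero]
    exact pi_eq_sum_univ' c
  rw [hcd]
  refine Submodule.sum_mem _ fun i _ ↦ Submodule.smul_mem _ _ (Submodule.subset_span ⟨?_, ?_⟩)
  · change Fintype.linearCombination F v (d i) = 0
    simp only [d, map_sub, map_sum, map_smul, Fintype.linearCombination_apply_single, one_smul]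
    simp only [algebraMap_smul, hq, sub_self]
  · intro j
    refine ⟨(Pi.single i 1 - ∑ k, q i k • Pi.single (b k) 1 : ι → K) j, ?_⟩
    simp [d, Pi.single_apply, apply_ite (algebraMap K F), Algebra.smul_def, -algebraMap_smul]

/-- Assuming Baker's theorem (if `ℓ₁, …, ℓ_m` are logarithms of algebraic numbers that are
`ℚ`-linearly independent, then `1, ℓ₁, …, ℓ_m` are `ℚ̄`-linearly independent), the space of
`ℚ̄`-linear relations among logarithms `ℓ₁, …, ℓₙ` of algebraic numbers is spanned over `ℚ̄`
by its rational points. -/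
theorem qbar_relations_spanned_by_rational_relations
    (hBaker : ∀ (m : ℕ) (L : Fin m → ℂ),
      (∀ i, IsAlgebraic ℚ (Complex.exp (L i))) → LinearIndependent ℚ L →
        LinearIndependent Qbar (Fin.cons (1:ℂ) L))
    (n : ℕ) (ℓ : Fin n → ℂ) (hℓ : ∀ i, IsAlgebraic ℚ (Complex.exp (ℓ i)))
    (c : Fin n → Qbar) (hc : ∑ i, (c i : ℂ) * ℓ i = 0) :
    c ∈ Submodule.span Qbar
        {d : Fin n → Qbar | (∑ i, (d i : ℂ) * ℓ i = 0)
          ∧ ∀ i, ∃ q : ℚ, (d i : ℂ) = (q : ℂ)} := by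
  have hspan := mem_span_relations_of_linearIndependent (K := ℚ) (F := Qbar) ℓ
    (fun m a ha ↦ by
      simpa [Function.comp_def] using
        (hBaker m (ℓ ∘ a) (fun i ↦ hℓ (a i)) ha).comp Fin.succ (Fin.succ_injective m)) c hc
  refine Submodule.span_mono ?_ hspan
  refine fun d hd ↦ ⟨hd.1, fun i ↦ ?_⟩
  obtain ⟨q, hq⟩ := hd.2 i
  exact ⟨q, by rw [hq]; simp⟩
end
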